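/- Let (η̄, ω̄, V̄, ū) be a constant equilibrium of the power network with constant demand P^l (i.e. Dᵀω̄ = 0, 0 = ū − DΓ(V̄)sin(η̄) − Aω̄ − P^l, E(η̄)V̄ = Ē_fd), and suppose η̄ ∈ (−π/2, π/2)^m, V̄ has positive entries, and E(η̄) − diag(V̄)⁻¹|D|Γ(V̄)diag(sin(η̄))diag(cos(η̄))⁻¹diag(sin(η̄))|D|ᵀdiag(V̄)⁻¹ is positive definite (|D| the entrywise absolute value of D). Then there exists a neighborhood of (η̄, ω̄, V̄) such that every solution (η, ω, V) : [0,∞) → ℝ^m × ℝⁿ × ℝⁿ of η̇ = Dᵀω, Mω̇ = ū − DΓ(V)sin(η) − Aω − P^l, TV̇ = −E(η)V + Ē_fd starting in this neighborhood is bounded, satisfies ω(t) → ω̄ and E(η(t))V(t) − Ē_fd → 0 as t → ∞, and converges asymptotically to the set of constant equilibria of the system with input ū (in the sense that the distance of (η(t), ω(t), V(t)) to this set of equilibria tends to 0). -/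

import Mathlib

open Matrix Real Filter Topology Set

noncomputable section

/-- `Vec n` is `ℝⁿ`. -/
abbrev Vec (n : ℕ) := Fin n → ℝ

/-- Incidence matrix of the (undirected, arbitrarily oriented) graph whose `m` edges have
endpoints `ep1 k` (positive end) and `ep2 k` (negative end). -/
def incD {n m : ℕ} (ep1 ep2 : Fin m → Fin n) : Matrix (Fin n) (Fin m) ℝ :=
  Matrix.of fun i k => if i = ep1 k then 1 else if i = ep2 k then -1 else 0

/-- `Γ(V) = diag(γ₁,…,γ_m)`, `γ_k = V_i V_j B_{ij}` for edge `k = {i,j}`. -/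
def Gam {n m : ℕ} (ep1 ep2 : Fin m → Fin n) (B : Fin m → ℝ) (V : Vec n) :
    Matrix (Fin m) (Fin m) ℝ :=
  Matrix.diagonal fun k => V (ep1 k) * V (ep2 k) * B k

/-- The matrix `E(η)`. -/
def Emat {n m : ℕ} (ep1 ep2 : Fin m → Fin n) (B : Fin m → ℝ)
    (Bii Xd Xd' : Vec n) (η : Vec m) : Matrix (Fin n) (Fin n) ℝ :=
  Matrix.of fun i j =>
    if i = j then (1 - Bii i * (Xd i - Xd' i)) / (Xd i - Xd' i)
    else -∑ k, (if (ep1 k = i ∧ ep2 k = j) ∨ (ep1 k = j ∧ ep2 k = i)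
      then B k * Real.cos (η k) else 0)

/-- The diagonal matrix `F`. -/
def Fmat {n : ℕ} (Bii Xd Xd' : Vec n) : Matrix (Fin n) (Fin n) ℝ :=
  Matrix.diagonal fun i => (1 - Bii i * (Xd i - Xd' i)) / (Xd i - Xd' i)

/-- componentwise sine -/
def sinv {m : ℕ} (η : Vec m) : Vec m := fun k => Real.sin (η k)
/-- componentwise cosine -/
def cosv {m : ℕ} (η : Vec m) : Vec m := fun k => Real.cos (η k)

/-- The storage function `W₂` with reference point `(ηb, Vb)`. -/
def W2 {n m : ℕ} (ep1 ep2 : Fin m → Fin n) (B : Fin m → ℝ) (Bii Xd Xd' : Vec n)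
    (Efd : Vec n) (ηb : Vec m) (Vb : Vec n) (η : Vec m) (V : Vec n) : ℝ :=
  -((1 : Vec m) ⬝ᵥ (Gam ep1 ep2 B V).mulVec (cosv η))
    + (1 : Vec m) ⬝ᵥ (Gam ep1 ep2 B Vb).mulVec (cosv ηb)
    - ((Gam ep1 ep2 B Vb).mulVec (sinv ηb)) ⬝ᵥ (η - ηb)
    - Efd ⬝ᵥ (V - Vb)
    + (1 / 2) * (V ⬝ᵥ (Fmat Bii Xd Xd').mulVec V)
    - (1 / 2) * (Vb ⬝ᵥ (Fmat Bii Xd Xd').mulVec Vb)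

/-- entrywise absolute value `|D|` of the incidence matrix. -/
def absD {n m : ℕ} (ep1 ep2 : Fin m → Fin n) : Matrix (Fin n) (Fin m) ℝ :=
  Matrix.of fun i k => |incD ep1 ep2 i k|

/-- The matrix `E(η̄) − diag(V̄)⁻¹|D|Γ(V̄)diag(sin η̄)diag(cos η̄)⁻¹diag(sin η̄)|D|ᵀdiag(V̄)⁻¹`
appearing in Assumption 3. -/
def Schur {n m : ℕ} (ep1 ep2 : Fin m → Fin n) (B : Fin m → ℝ) (Bii Xd Xd' : Vec n)
    (ηb : Vec m) (Vb : Vec n) : Matrix (Fin n) (Fin n) ℝ :=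
  Emat ep1 ep2 B Bii Xd Xd' ηb -
    (Matrix.diagonal fun i => (Vb i)⁻¹) * absD ep1 ep2 * Gam ep1 ep2 B Vb *
      Matrix.diagonal (sinv ηb) * (Matrix.diagonal (cosv ηb))⁻¹ *
      Matrix.diagonal (sinv ηb) * (absD ep1 ep2)ᵀ * (Matrix.diagonal fun i => (Vb i)⁻¹)

/-- Second-order sufficient condition for a strict local minimum, phrased with derivatives along
lines. -/
theorem exists_closedBall_strict_min {E : Type*} [NormedAddCommGroup E] [NormedSpace ℝ E]
    [ProperSpace E] (W : E → ℝ) (dW d2W : E → E → ℝ) (x₀ : E)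
    (hW : ∀ x v (s : ℝ), HasDerivAt (fun s : ℝ => W (x + s • v)) (dW (x + s • v) v) s)
    (hdW : ∀ x v (s : ℝ), HasDerivAt (fun s : ℝ => dW (x + s • v) v) (d2W (x + s • v) v) s)
    (hcrit : ∀ v, dW x₀ v = 0)
    (hcont : Continuous fun p : E × E => d2W p.1 p.2)
    (hhom : ∀ x v (c : ℝ), d2W x (c • v) = c ^ 2 * d2W x v)
    (hpos : ∀ v, v ≠ 0 → 0 < d2W x₀ v) :
    ∃ r > 0, ∀ x ∈ Metric.closedBall x₀ r, x ≠ x₀ → W x₀ < W x := by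
  have hopen : IsOpen {p : E × E | 0 < d2W p.1 p.2} := isOpen_lt continuous_const hcont
  obtain ⟨u, v, hu, -, hxu, hsv, huv⟩ := generalized_tube_lemma
    (isCompact_singleton (x := x₀)) (isCompact_sphere (0 : E) 1) hopen (by
      rintro ⟨a, b⟩ ⟨ha, hb⟩
      rw [mem_singleton_iff] at ha
      simp only at ha hb
      subst ha
      exact hpos b (by rintro rfl; simp at hb))
  obtain ⟨r, hr, hru⟩ := Metric.nhds_basis_closedBall.mem_iff.1
    (hu.mem_nhds (hxu (mem_singleton x₀)))
  have key : ∀ x ∈ Metric.closedBall x₀ r, ∀ w : E, w ≠ 0 → 0 < d2W x w := by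
    intro x hx w hw
    have hw' : 0 < ‖w‖ := norm_pos_iff.2 hw
    have h1 : (x, ‖w‖⁻¹ • w) ∈ u ×ˢ v :=
      ⟨hru hx, hsv (by simp [norm_smul, hw'.ne'])⟩
    have h2 : 0 < d2W x (‖w‖⁻¹ • w) := huv h1
    rw [hhom] at h2
    exact pos_of_mul_pos_right h2 (by positivity)
  refine ⟨r, hr, fun x hx hne => ?_⟩
  set w := x - x₀ with hw
  have hw0 : w ≠ 0 := sub_ne_zero.2 hne
  have hmem : ∀ s ∈ Icc (0 : ℝ) 1, x₀ + s • w ∈ Metric.closedBall x₀ r := by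
    intro s hs
    rw [mem_closedBall_iff_norm] at hx ⊢
    rw [add_sub_cancel_left, norm_smul, Real.norm_of_nonneg hs.1]
    calc s * ‖w‖ ≤ 1 * ‖w‖ := by gcongr; exact hs.2
      _ ≤ r := by rwa [one_mul]
  have mono1 : StrictMonoOn (fun s : ℝ => dW (x₀ + s • w) w) (Icc 0 1) := by
    refine strictMonoOn_of_deriv_pos (convex_Icc 0 1)
      (fun s _ => (hdW x₀ w s).continuousAt.continuousWithinAt) fun s hs => ?_
    rw [(hdW x₀ w s).deriv]
    exact key _ (hmem s (interior_subset hs)) w hw0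
  have mono2 : StrictMonoOn (fun s : ℝ => W (x₀ + s • w)) (Icc 0 1) := by
    refine strictMonoOn_of_deriv_pos (convex_Icc 0 1)
      (fun s _ => (hW x₀ w s).continuousAt.continuousWithinAt) fun s hs => ?_
    rw [(hW x₀ w s).deriv]
    rw [interior_Icc] at hs
    have := mono1 (left_mem_Icc.2 zero_le_one) ⟨hs.1.le, hs.2.le⟩ hs.1
    simpa [hcrit] using this
  have := mono2 (left_mem_Icc.2 zero_le_one) (right_mem_Icc.2 zero_le_one) zero_lt_one
  simpa [hw] using this

/-- Barbalat's lemma: a convergent function with uniformly continuous derivative has vanishing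
derivative at infinity. -/
theorem tendsto_deriv_zero_of_uniformContinuousOn {E : Type*} [NormedAddCommGroup E]
    [NormedSpace ℝ E] {h h' : ℝ → E} {l : E} (hd : ∀ t ≥ (0 : ℝ), HasDerivAt h (h' t) t)
    (hlim : Tendsto h atTop (𝓝 l)) (huc : UniformContinuousOn h' (Ici 0)) :
    Tendsto h' atTop (𝓝 0) := by
  rw [Metric.tendsto_nhds]
  intro ε hε
  obtain ⟨δ, hδ, hδ'⟩ := Metric.uniformContinuousOn_iff_le.1 huc (ε / 2) (half_pos hε)
  have hdiff : Tendsto (fun t => h (t + δ) - h t) atTop (𝓝 0) := by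
    simpa using (hlim.comp (tendsto_atTop_add_const_right _ δ tendsto_id)).sub hlim
  filter_upwards [eventually_ge_atTop 0, Metric.tendsto_nhds.1 hdiff (δ * (ε / 2)) (by positivity)]
    with t ht hsmall
  rw [dist_zero_right] at hsmall ⊢
  have hmv : ‖(h (t + δ) - (t + δ) • h' t) - (h t - t • h' t)‖ ≤ ε / 2 * ‖t + δ - t‖ := by
    refine Convex.norm_image_sub_le_of_norm_hasDerivWithin_le (s := Icc t (t + δ))
      (f := fun s => h s - s • h' t) (f' := fun s => h' s - (1 : ℝ) • h' t) (fun s hs => ?_)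
      (fun s hs => ?_) (convex_Icc _ _) (left_mem_Icc.2 (by linarith))
      (right_mem_Icc.2 (by linarith))
    · exact ((hd s (le_trans ht hs.1)).sub ((hasDerivAt_id s).smul_const _)).hasDerivWithinAt
    · rw [one_smul, ← dist_eq_norm]
      refine hδ' s (le_trans ht hs.1) t ht ?_
      rw [Real.dist_eq, abs_of_nonneg (by linarith [hs.1])]
      linarith [hs.2]
  have hrew : (h (t + δ) - (t + δ) • h' t) - (h t - t • h' t) = (h (t + δ) - h t) - δ • h' t := by
    rw [add_smul]; abel
  rw [hrew, add_sub_cancel_left, Real.norm_of_nonneg hδ.le] at hmv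
  have htri : ‖δ • h' t‖ ≤ ‖h (t + δ) - h t‖ + ‖(h (t + δ) - h t) - δ • h' t‖ := by
    simpa using norm_sub_le (h (t + δ) - h t) ((h (t + δ) - h t) - δ • h' t)
  rw [norm_smul, Real.norm_of_nonneg hδ.le] at htri
  have : δ * ‖h' t‖ < δ * ε := by linarith
  exact lt_of_mul_lt_mul_left this hδ.le

/-- Continuous functions of a solution of an autonomous ODE which stays in a compact set are
uniformly continuous in time. -/
theorem uniformContinuousOn_comp_solution {E F : Type*} [NormedAddCommGroup E]
    [NormedSpace ℝ E] [PseudoMetricSpace F] {f : E → E} (hf : Continuous f) {K : Set E}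
    (hK : IsCompact K) {x : ℝ → E} (hx : ∀ t ≥ (0 : ℝ), HasDerivAt x (f (x t)) t)
    (hxK : ∀ t ≥ (0 : ℝ), x t ∈ K) {g : E → F} (hg : Continuous g) :
    UniformContinuousOn (fun t => g (x t)) (Ici 0) := by
  obtain ⟨C, hC⟩ := hK.exists_bound_of_continuousOn hf.continuousOn
  have hlip : LipschitzOnWith C.toNNReal x (Ici 0) :=
    Convex.lipschitzOnWith_of_nnnorm_hasDerivWithin_le (convex_Ici 0)
      (fun t ht => (hx t ht).hasDerivWithinAt)
      (fun t ht => by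
        rw [← NNReal.coe_le_coe]
        exact (hC _ (hxK t ht)).trans (Real.le_coe_toNNReal C))
  exact (hK.uniformContinuousOn_of_continuous hg.continuousOn).comp hlip.uniformContinuousOn hxK

/-- Solutions starting close to a strict local minimum of a Lyapunov function stay close to it,
and the dissipation rate vanishes asymptotically. -/
theorem exists_nhds_trapped_of_strict_min {E : Type*} [NormedAddCommGroup E] [NormedSpace ℝ E]
    [ProperSpace E] {f : E → E} (hf : Continuous f) {W g : E → ℝ} (hW : Continuous W)
    (hg : Continuous g) (hg0 : ∀ x, 0 ≤ g x) {x₀ : E} {r : ℝ} (hr : 0 < r)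
    (hmin : ∀ x ∈ Metric.closedBall x₀ r, x ≠ x₀ → W x₀ < W x) :
    ∃ U ∈ 𝓝 x₀, ∀ x : ℝ → E, x 0 ∈ U → (∀ t ≥ (0 : ℝ), HasDerivAt x (f (x t)) t) →
      (∀ t ≥ (0 : ℝ), HasDerivAt (fun t => W (x t)) (-g (x t)) t) →
      (∀ t ≥ (0 : ℝ), x t ∈ Metric.closedBall x₀ r) ∧
        Tendsto (fun t => g (x t)) atTop (𝓝 0) := by
  obtain ⟨c, hc, hcs⟩ := (isCompact_sphere x₀ r).exists_forall_le' hW.continuousOn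
    (a := W x₀) (fun x hx => hmin x (Metric.sphere_subset_closedBall hx)
      (by rintro rfl; simp at hx; exact hr.ne hx))
  refine ⟨Metric.ball x₀ r ∩ {x | W x < c}, inter_mem (Metric.ball_mem_nhds _ hr)
    ((isOpen_lt hW continuous_const).mem_nhds hc), fun x hx0 hx hWx => ?_⟩
  have hanti : AntitoneOn (fun t => W (x t)) (Ici 0) := by
    refine antitoneOn_of_deriv_nonpos (convex_Ici 0)
      (fun t ht => (hWx t ht).continuousAt.continuousWithinAt)
      (fun t ht => (hWx t (interior_subset ht)).differentiableAt.differentiableWithinAt)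
      fun t ht => ?_
    rw [(hWx t (interior_subset ht)).deriv]
    exact neg_nonpos.2 (hg0 _)
  have htrap : ∀ t ≥ (0 : ℝ), x t ∈ Metric.closedBall x₀ r := by
    intro t ht
    by_contra hcon
    rw [Metric.mem_closedBall, not_le] at hcon
    have hcont : ContinuousOn (fun s => dist (x s) x₀) (Icc 0 t) := fun s hs =>
      ContinuousAt.continuousWithinAt ((hx s hs.1).continuousAt.dist continuousAt_const)
    obtain ⟨s, hs, hsr⟩ := intermediate_value_Icc ht hcont
      (⟨(Metric.mem_ball.1 hx0.1).le, hcon.le⟩ : r ∈ Icc _ _)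
    have h1 : c ≤ W (x s) := hcs _ hsr
    have h2 : W (x s) ≤ W (x 0) := hanti (mem_Ici.2 le_rfl) hs.1 hs.1
    have h3 : W (x 0) < c := hx0.2
    linarith
  refine ⟨htrap, ?_⟩
  have hlow : ∀ t ≥ (0 : ℝ), W x₀ ≤ W (x t) := fun t ht => by
    by_cases h : x t = x₀
    · rw [h]
    · exact (hmin _ (htrap t ht) h).le
  have hlim : ∃ l, Tendsto (fun t => W (x t)) atTop (𝓝 l) := by
    have hA : Antitone fun t => W (x (max 0 t)) := fun s t hst =>
      hanti (mem_Ici.2 (le_max_left _ _)) (mem_Ici.2 (le_max_left _ _)) (max_le_max_left _ hst)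
    refine ⟨_, (tendsto_atTop_ciInf hA ⟨W x₀, ?_⟩).congr' ?_⟩
    · rintro _ ⟨t, rfl⟩
      exact hlow _ (le_max_left _ _)
    · filter_upwards [eventually_ge_atTop 0] with t ht
      rw [max_eq_right ht]
  obtain ⟨l, hl⟩ := hlim
  have := tendsto_deriv_zero_of_uniformContinuousOn hWx hl
    (uniformContinuousOn_comp_solution hf (isCompact_closedBall x₀ r) hx htrap hg.neg)
  simpa using this.neg

/-- A function with values in a compact set along which `h` vanishes asymptotically converges to
the zero set of `h`. -/
theorem tendsto_infDist_zeros {E F : Type*} [PseudoMetricSpace E] [NormedAddCommGroup F]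
    {K : Set E} (hK : IsCompact K) {h : E → F} (hh : Continuous h) {x : ℝ → E}
    (hxK : ∀ t ≥ (0 : ℝ), x t ∈ K) (hlim : Tendsto (fun t => h (x t)) atTop (𝓝 0)) :
    Tendsto (fun t => Metric.infDist (x t) {p | h p = 0}) atTop (𝓝 0) := by
  rw [Metric.tendsto_nhds]
  intro ε hε
  have hKε : IsCompact (K ∩ {p | ε ≤ Metric.infDist p {p | h p = 0}}) :=
    hK.inter_right (isClosed_le continuous_const (Metric.continuous_infDist_pt _))
  obtain ⟨δ, hδ, hδ'⟩ := hKε.exists_forall_le' hh.norm.continuousOn (a := 0) (fun p hp =>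
    norm_pos_iff.2 fun h0 => by
      have h1 : Metric.infDist p {p | h p = 0} = 0 := Metric.infDist_zero_of_mem h0
      have h2 : ε ≤ Metric.infDist p {p | h p = 0} := hp.2
      linarith)
  filter_upwards [eventually_ge_atTop 0, Metric.tendsto_nhds.1 hlim δ hδ] with t ht hs
  rw [dist_zero_right] at hs
  rw [Real.dist_0_eq_abs, abs_of_nonneg Metric.infDist_nonneg]
  by_contra! hcon
  exact absurd (hδ' _ ⟨hxK t ht, hcon⟩) (not_le.2 hs)

section Energy

variable {n m : ℕ} (ep1 ep2 : Fin m → Fin n) (B : Fin m → ℝ) (F Md Efd ωb : Vec n) (σ : Vec m)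

/-- The total energy of the network: kinetic energy relative to `ωb`, plus the potential of
`(η, V)` tilted by `σ` and `Efd`. -/
def energy (p : Vec m × Vec n × Vec n) : ℝ :=
  ∑ i, (Md i * (p.2.1 i - ωb i) ^ 2 / 2 + F i * p.2.2 i ^ 2 / 2 - Efd i * p.2.2 i) -
    ∑ k, (B k * (p.2.2 (ep1 k) * p.2.2 (ep2 k)) * Real.cos (p.1 k) + σ k * p.1 k)

/-- The derivative of `energy` at `p` in direction `v`. -/
def energyDeriv (p v : Vec m × Vec n × Vec n) : ℝ :=
  ∑ i, (Md i * (p.2.1 i - ωb i) * v.2.1 i + (F i * p.2.2 i - Efd i) * v.2.2 i) -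
    ∑ k, (B k * (v.2.2 (ep1 k) * p.2.2 (ep2 k) + p.2.2 (ep1 k) * v.2.2 (ep2 k)) *
      Real.cos (p.1 k) - B k * (p.2.2 (ep1 k) * p.2.2 (ep2 k)) * Real.sin (p.1 k) * v.1 k
        + σ k * v.1 k)

/-- The second derivative of `energy` at `p` in direction `v`. -/
def energyDeriv2 (p v : Vec m × Vec n × Vec n) : ℝ :=
  ∑ i, (Md i * v.2.1 i ^ 2 + F i * v.2.2 i ^ 2) -
    ∑ k, (2 * B k * (v.2.2 (ep1 k) * v.2.2 (ep2 k)) * Real.cos (p.1 k) -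
      2 * B k * (v.2.2 (ep1 k) * p.2.2 (ep2 k) + p.2.2 (ep1 k) * v.2.2 (ep2 k)) *
        Real.sin (p.1 k) * v.1 k -
      B k * (p.2.2 (ep1 k) * p.2.2 (ep2 k)) * Real.cos (p.1 k) * v.1 k ^ 2)

theorem hasDerivAt_components {x : ℝ → Vec m × Vec n × Vec n} {v : Vec m × Vec n × Vec n} {t : ℝ}
    (hx : HasDerivAt x v t) :
    (∀ k, HasDerivAt (fun s => (x s).1 k) (v.1 k) t) ∧
      (∀ i, HasDerivAt (fun s => (x s).2.1 i) (v.2.1 i) t) ∧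
      ∀ i, HasDerivAt (fun s => (x s).2.2 i) (v.2.2 i) t :=
  ⟨hasDerivAt_pi.1 hx.fst, hasDerivAt_pi.1 hx.snd.fst, hasDerivAt_pi.1 hx.snd.snd⟩

theorem hasDerivAt_energy {x : ℝ → Vec m × Vec n × Vec n} {v : Vec m × Vec n × Vec n} {t : ℝ}
    (hx : HasDerivAt x v t) :
    HasDerivAt (fun s => energy ep1 ep2 B F Md Efd ωb σ (x s))
      (energyDeriv ep1 ep2 B F Md Efd ωb σ (x t) v) t := by
  obtain ⟨hη, hω, hV⟩ := hasDerivAt_components hx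
  refine HasDerivAt.sub (HasDerivAt.fun_sum fun i _ => ?_) (HasDerivAt.fun_sum fun k _ => ?_)
  · refine ((((((hω i).sub_const (ωb i)).fun_pow 2).const_mul (Md i)).div_const 2).fun_add
      ((((hV i).fun_pow 2).const_mul (F i)).div_const 2) |>.fun_sub
      ((hV i).const_mul (Efd i))).congr_deriv ?_
    push_cast
    ring
  · refine (((((hV (ep1 k)).fun_mul (hV (ep2 k))).const_mul (B k)).fun_mul (hη k).cos).fun_add
      ((hη k).const_mul (σ k))).congr_deriv ?_
    ring

theorem hasDerivAt_energyDeriv (p v : Vec m × Vec n × Vec n) (t : ℝ) :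
    HasDerivAt (fun s : ℝ => energyDeriv ep1 ep2 B F Md Efd ωb σ (p + s • v) v)
      (energyDeriv2 ep1 ep2 B F Md (p + t • v) v) t := by
  have hx : HasDerivAt (fun s : ℝ => p + s • v) v t := by
    simpa using ((hasDerivAt_id t).smul_const v).const_add p
  obtain ⟨hη, hω, hV⟩ := hasDerivAt_components hx
  refine HasDerivAt.sub (HasDerivAt.fun_sum fun i _ => ?_) (HasDerivAt.fun_sum fun k _ => ?_)
  · refine (((((hω i).sub_const (ωb i)).const_mul (Md i)).mul_const (v.2.1 i)).fun_add
      ((((hV i).const_mul (F i)).sub_const (Efd i)).mul_const (v.2.2 i))).congr_deriv ?_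
    ring
  · refine ((((((hV (ep2 k)).const_mul (v.2.2 (ep1 k))).fun_add
      ((hV (ep1 k)).mul_const (v.2.2 (ep2 k)))).const_mul (B k)).fun_mul (hη k).cos).fun_sub
      (((((hV (ep1 k)).fun_mul (hV (ep2 k))).const_mul (B k)).fun_mul (hη k).sin).mul_const
        (v.1 k)) |>.add_const (σ k * v.1 k)).congr_deriv ?_
    ring

theorem continuous_energy : Continuous (energy ep1 ep2 B F Md Efd ωb σ) := by
  unfold energy
  fun_prop

theorem continuous_energyDeriv2 :
    Continuous fun q : (Vec m × Vec n × Vec n) × (Vec m × Vec n × Vec n) =>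
      energyDeriv2 ep1 ep2 B F Md q.1 q.2 := by
  unfold energyDeriv2
  fun_prop

theorem energyDeriv2_smul (p v : Vec m × Vec n × Vec n) (c : ℝ) :
    energyDeriv2 ep1 ep2 B F Md p (c • v) = c ^ 2 * energyDeriv2 ep1 ep2 B F Md p v := by
  simp only [energyDeriv2, Prod.smul_fst, Prod.smul_snd, Pi.smul_apply, smul_eq_mul, mul_sub,
    Finset.mul_sum]
  congr 1 <;> refine Finset.sum_congr rfl fun _ _ => ?_ <;> ring

end Energy

section Network

variable {n m : ℕ} {ep1 ep2 : Fin m → Fin n}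

theorem incD_transpose_mulVec_apply (hep : ∀ k, ep1 k ≠ ep2 k) (w : Vec n) (k : Fin m) :
    (incD ep1 ep2)ᵀ.mulVec w k = w (ep1 k) - w (ep2 k) := by
  have h : ∀ i, (incD ep1 ep2) i k * w i =
      (if i = ep1 k then w i else 0) - if i = ep2 k then w i else 0 := by
    intro i
    simp only [incD, Matrix.of_apply]
    split_ifs with h1 h2
    · exact absurd (h1.symm.trans h2) (hep k)
    all_goals ring
  simp only [Matrix.mulVec, dotProduct, Matrix.transpose_apply, h, Finset.sum_sub_distrib,
    Finset.sum_ite_eq', Finset.mem_univ, if_true]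

theorem absD_transpose_mulVec_apply (hep : ∀ k, ep1 k ≠ ep2 k) (w : Vec n) (k : Fin m) :
    (absD ep1 ep2)ᵀ.mulVec w k = w (ep1 k) + w (ep2 k) := by
  have h : ∀ i, (absD ep1 ep2) i k * w i =
      (if i = ep1 k then w i else 0) + if i = ep2 k then w i else 0 := by
    intro i
    simp only [absD, incD, Matrix.of_apply]
    split_ifs with h1 h2
    · exact absurd (h1.symm.trans h2) (hep k)
    all_goals simp
  simp only [Matrix.mulVec, dotProduct, Matrix.transpose_apply, h, Finset.sum_add_distrib,
    Finset.sum_ite_eq', Finset.mem_univ, if_true]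

theorem dotProduct_Emat_mulVec (hep : ∀ k, ep1 k ≠ ep2 k) (B : Fin m → ℝ)
    (Bii Xd Xd' : Vec n) (η : Vec m) (b V : Vec n) :
    b ⬝ᵥ (Emat ep1 ep2 B Bii Xd Xd' η).mulVec V =
      ∑ i, (1 - Bii i * (Xd i - Xd' i)) / (Xd i - Xd' i) * V i * b i -
        ∑ k, B k * (b (ep1 k) * V (ep2 k) + V (ep1 k) * b (ep2 k)) * Real.cos (η k) := by
  have hE : ∀ i j, Emat ep1 ep2 B Bii Xd Xd' η i j =
      (if i = j then (1 - Bii i * (Xd i - Xd' i)) / (Xd i - Xd' i) else 0) -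
        ∑ k, ((if ep1 k = i then if ep2 k = j then B k * Real.cos (η k) else 0 else 0) +
          if ep2 k = i then if ep1 k = j then B k * Real.cos (η k) else 0 else 0) := by
    intro i j
    simp only [Emat, Matrix.of_apply]
    split_ifs with hij
    · subst hij
      rw [Finset.sum_eq_zero, sub_zero]
      intro k _
      have := hep k
      split_ifs <;> simp_all
    · rw [zero_sub]
      congr 1
      refine Finset.sum_congr rfl fun k _ => ?_
      have := hep k
      by_cases h1 : ep1 k = i <;> by_cases h2 : ep2 k = j <;> by_cases h3 : ep1 k = j <;>
        by_cases h4 : ep2 k = i <;> simp_all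
  have hrow : ∀ i, (Emat ep1 ep2 B Bii Xd Xd' η).mulVec V i =
      (1 - Bii i * (Xd i - Xd' i)) / (Xd i - Xd' i) * V i -
        ∑ k, ((if ep1 k = i then B k * Real.cos (η k) * V (ep2 k) else 0) +
          if ep2 k = i then B k * Real.cos (η k) * V (ep1 k) else 0) := by
    intro i
    simp only [Matrix.mulVec, dotProduct, hE, sub_mul, Finset.sum_sub_distrib, ite_mul, zero_mul,
      Finset.sum_ite_eq, Finset.mem_univ, if_true, Finset.sum_mul]
    congr 1
    rw [Finset.sum_comm]
    refine Finset.sum_congr rfl fun k _ => ?_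
    simp only [add_mul, Finset.sum_add_distrib]
    congr 1 <;> split_ifs <;> simp [ite_mul]
  simp only [dotProduct, hrow, mul_sub, Finset.sum_sub_distrib, Finset.mul_sum]
  congr 1
  · exact Finset.sum_congr rfl fun i _ => by ring
  · rw [Finset.sum_comm]
    refine Finset.sum_congr rfl fun k _ => ?_
    simp only [mul_add, Finset.sum_add_distrib, mul_ite, mul_zero, Finset.sum_ite_eq,
      Finset.mem_univ, if_true]
    ring

theorem dotProduct_Schur_mulVec (hep : ∀ k, ep1 k ≠ ep2 k) (B : Fin m → ℝ)
    (Bii Xd Xd' : Vec n) {ηb : Vec m} {Vb : Vec n} (hcos : ∀ k, Real.cos (ηb k) ≠ 0) (b : Vec n) :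
    b ⬝ᵥ (Schur ep1 ep2 B Bii Xd Xd' ηb Vb).mulVec b =
      b ⬝ᵥ (Emat ep1 ep2 B Bii Xd Xd' ηb).mulVec b -
        ∑ k, Vb (ep1 k) * Vb (ep2 k) * B k * Real.sin (ηb k) ^ 2 / Real.cos (ηb k) *
          (b (ep1 k) / Vb (ep1 k) + b (ep2 k) / Vb (ep2 k)) ^ 2 := by
  have hinv : (Matrix.diagonal (cosv ηb))⁻¹ = Matrix.diagonal fun k => (Real.cos (ηb k))⁻¹ := by
    refine Matrix.inv_eq_right_inv ?_
    rw [Matrix.diagonal_mul_diagonal, ← Matrix.diagonal_one]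
    congr 1
    funext k
    exact mul_inv_cancel₀ (hcos k)
  rw [Schur, Matrix.sub_mulVec, dotProduct_sub, hinv]
  congr 1
  simp only [← Matrix.mulVec_mulVec]
  rw [Matrix.dotProduct_mulVec, ← Matrix.mulVec_transpose, Matrix.diagonal_transpose,
    Matrix.dotProduct_mulVec, ← Matrix.mulVec_transpose]
  simp only [dotProduct, Gam, Matrix.mulVec_diagonal, absD_transpose_mulVec_apply hep, sinv]
  exact Finset.sum_congr rfl fun k _ => by ring

theorem energyDeriv_eq (hep : ∀ k, ep1 k ≠ ep2 k) (B : Fin m → ℝ) (Bii Xd Xd' Md Efd ωb : Vec n)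
    (σ : Vec m) (p v : Vec m × Vec n × Vec n) :
    energyDeriv ep1 ep2 B (fun i => (1 - Bii i * (Xd i - Xd' i)) / (Xd i - Xd' i)) Md Efd ωb σ p v
      = (p.2.1 - ωb) ⬝ᵥ (Matrix.diagonal Md).mulVec v.2.1 +
        v.2.2 ⬝ᵥ ((Emat ep1 ep2 B Bii Xd Xd' p.1).mulVec p.2.2 - Efd) +
        ((Gam ep1 ep2 B p.2.2).mulVec (sinv p.1) - σ) ⬝ᵥ v.1 := by
  rw [dotProduct_sub, dotProduct_Emat_mulVec hep]
  simp only [energyDeriv, dotProduct, Gam, Matrix.mulVec_diagonal, sinv, Pi.sub_apply]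
  simp only [sub_mul, Finset.sum_add_distrib, Finset.sum_sub_distrib, mul_sub]
  have h1 : ∑ i, Efd i * v.2.2 i = ∑ i, v.2.2 i * Efd i :=
    Finset.sum_congr rfl fun i _ => mul_comm _ _
  have h2 : ∑ k, B k * (p.2.2 (ep1 k) * p.2.2 (ep2 k)) * Real.sin (p.1 k) * v.1 k =
      ∑ k, p.2.2 (ep1 k) * p.2.2 (ep2 k) * B k * Real.sin (p.1 k) * v.1 k :=
    Finset.sum_congr rfl fun k _ => by ring
  have h3 : ∑ i, Md i * p.2.1 i * v.2.1 i = ∑ i, p.2.1 i * (Md i * v.2.1 i) :=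
    Finset.sum_congr rfl fun i _ => by ring
  have h4 : ∑ i, Md i * ωb i * v.2.1 i = ∑ i, ωb i * (Md i * v.2.1 i) :=
    Finset.sum_congr rfl fun i _ => by ring
  rw [h1, h2, h3, h4]
  ring

theorem energyDeriv2_equilibrium (hep : ∀ k, ep1 k ≠ ep2 k) (B : Fin m → ℝ)
    (Bii Xd Xd' Md : Vec n) {ηb : Vec m} (ωb : Vec n) {Vb : Vec n}
    (hcos : ∀ k, Real.cos (ηb k) ≠ 0) (hVb : ∀ i, Vb i ≠ 0) (v : Vec m × Vec n × Vec n) :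
    energyDeriv2 ep1 ep2 B (fun i => (1 - Bii i * (Xd i - Xd' i)) / (Xd i - Xd' i)) Md
        (ηb, ωb, Vb) v =
      ∑ i, Md i * v.2.1 i ^ 2 + v.2.2 ⬝ᵥ (Schur ep1 ep2 B Bii Xd Xd' ηb Vb).mulVec v.2.2 +
        ∑ k, Vb (ep1 k) * Vb (ep2 k) * B k * Real.cos (ηb k) *
          (v.1 k + Real.sin (ηb k) / Real.cos (ηb k) *
            (v.2.2 (ep1 k) / Vb (ep1 k) + v.2.2 (ep2 k) / Vb (ep2 k))) ^ 2 := by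
  rw [dotProduct_Schur_mulVec hep _ _ _ _ hcos, dotProduct_Emat_mulVec hep, energyDeriv2,
    Finset.sum_add_distrib, add_sub_assoc, add_assoc, add_left_cancel_iff, sub_sub, sub_add,
    ← Finset.sum_add_distrib, ← Finset.sum_sub_distrib]
  congr 1
  · exact Finset.sum_congr rfl fun i _ => by ring
  · refine Finset.sum_congr rfl fun k _ => ?_
    have h0 := hcos k
    have h1 := hVb (ep1 k)
    have h2 := hVb (ep2 k)
    field_simp
    ring

theorem energyDeriv2_equilibrium_pos (hep : ∀ k, ep1 k ≠ ep2 k) {B : Fin m → ℝ}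
    (hB : ∀ k, 0 < B k) {Bii Xd Xd' Md : Vec n} (hM : ∀ i, 0 < Md i) {ηb : Vec m} (ωb : Vec n)
    {Vb : Vec n} (hcos : ∀ k, 0 < Real.cos (ηb k)) (hVb : ∀ i, 0 < Vb i)
    (hPD : (Schur ep1 ep2 B Bii Xd Xd' ηb Vb).PosDef) {v : Vec m × Vec n × Vec n} (hv : v ≠ 0) :
    0 < energyDeriv2 ep1 ep2 B (fun i => (1 - Bii i * (Xd i - Xd' i)) / (Xd i - Xd' i)) Md
      (ηb, ωb, Vb) v := by
  rw [energyDeriv2_equilibrium hep _ _ _ _ _ _ (fun k => (hcos k).ne') (fun i => (hVb i).ne')]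
  have hγ : ∀ k, 0 < Vb (ep1 k) * Vb (ep2 k) * B k * Real.cos (ηb k) := fun k =>
    mul_pos (mul_pos (mul_pos (hVb _) (hVb _)) (hB k)) (hcos k)
  have h1 : ∀ i ∈ Finset.univ, 0 ≤ Md i * v.2.1 i ^ 2 := fun i _ =>
    mul_nonneg (hM i).le (sq_nonneg _)
  have h3 : ∀ k ∈ Finset.univ, 0 ≤ Vb (ep1 k) * Vb (ep2 k) * B k * Real.cos (ηb k) *
      (v.1 k + Real.sin (ηb k) / Real.cos (ηb k) *
        (v.2.2 (ep1 k) / Vb (ep1 k) + v.2.2 (ep2 k) / Vb (ep2 k))) ^ 2 := fun k _ =>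
    mul_nonneg (hγ k).le (sq_nonneg _)
  by_cases hb : v.2.2 = 0
  · by_cases hc : v.2.1 = 0
    · obtain ⟨k, hk⟩ : ∃ k, v.1 k ≠ 0 := by
        by_contra! h
        exact hv (Prod.ext (funext h) (Prod.ext hc hb))
      simp only [hb, hc, Pi.zero_apply, zero_div, add_zero, mul_zero, zero_dotProduct] at h3 ⊢
      have := Finset.sum_pos' h3 ⟨k, Finset.mem_univ k, mul_pos (hγ k) (sq_pos_of_ne_zero hk)⟩
      simpa using this
    · obtain ⟨i, hi⟩ := Function.ne_iff.1 hc
      have := Finset.sum_pos' h1 ⟨i, Finset.mem_univ i, mul_pos (hM i) (sq_pos_of_ne_zero hi)⟩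
      have h3' := Finset.sum_nonneg h3
      rw [hb] at h3' ⊢
      rw [zero_dotProduct]
      linarith
  · have h2 : 0 < v.2.2 ⬝ᵥ (Schur ep1 ep2 B Bii Xd Xd' ηb Vb).mulVec v.2.2 := by
      simpa using hPD.dotProduct_mulVec_pos hb
    have := Finset.sum_nonneg h1
    have := Finset.sum_nonneg h3
    linarith

theorem continuous_Emat_mulVec (B : Fin m → ℝ) (Bii Xd Xd' : Vec n) :
    Continuous fun p : Vec m × Vec n × Vec n =>
      (Emat ep1 ep2 B Bii Xd Xd' p.1).mulVec p.2.2 := by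
  refine Continuous.matrix_mulVec (continuous_matrix fun i j => ?_) (by fun_prop)
  simp only [Emat, Matrix.of_apply]
  split_ifs
  · exact continuous_const
  · refine (continuous_finsetSum _ fun k _ => ?_).neg
    split_ifs <;> fun_prop

theorem continuous_powerBalance (B : Fin m → ℝ) (Ad Pl ub : Vec n) :
    Continuous fun p : Vec m × Vec n × Vec n =>
      ub - (incD ep1 ep2).mulVec ((Gam ep1 ep2 B p.2.2).mulVec (sinv p.1))
        - (Matrix.diagonal Ad).mulVec p.2.1 - Pl := by
  have h : Continuous fun p : Vec m × Vec n × Vec n =>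
      (Gam ep1 ep2 B p.2.2).mulVec (sinv p.1) := by
    refine continuous_pi fun k => ?_
    simp only [Gam, Matrix.mulVec_diagonal, sinv]
    fun_prop
  exact ((continuous_const.sub (continuous_const.matrix_mulVec h)).sub
    (continuous_const.matrix_mulVec (by fun_prop))).sub continuous_const

end Network

/-- Corollary 1: under Assumptions 2 and 3, there is a neighborhood of the
equilibrium `(η̄, ω̄, V̄)` such that every solution starting in it is bounded, its frequency
converges to `ω̄`, `E(η(t))V(t) − Ē_fd → 0`, and the solution converges to the set of
equilibria of the system with input `ū`. -/
theorem local_convergence_to_equilibria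
    {n m : ℕ} (ep1 ep2 : Fin m → Fin n) (hep : ∀ k, ep1 k ≠ ep2 k)
    (B : Fin m → ℝ) (hB : ∀ k, 0 < B k)
    (Bii Xd Xd' : Vec n)
    (Md Ad Td : Vec n) (hM : ∀ i, 0 < Md i) (hA : ∀ i, 0 < Ad i) (hT : ∀ i, 0 < Td i)
    (Efd Pl ub : Vec n)
    (ηb : Vec m) (ωb Vb : Vec n)
    (heq1 : (incD ep1 ep2)ᵀ.mulVec ωb = 0)
    (heq2 : (0 : Vec n) = ub - (incD ep1 ep2).mulVec ((Gam ep1 ep2 B Vb).mulVec (sinv ηb))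
      - (Matrix.diagonal Ad).mulVec ωb - Pl)
    (heq3 : (Emat ep1 ep2 B Bii Xd Xd' ηb).mulVec Vb = Efd)
    (hsec : ∀ k, ηb k ∈ Set.Ioo (-(π / 2)) (π / 2))
    (hVb : ∀ i, 0 < Vb i)
    (hPD : (Schur ep1 ep2 B Bii Xd Xd' ηb Vb).PosDef) :
    ∃ U ∈ 𝓝 ((ηb, ωb, Vb) : Vec m × Vec n × Vec n),
      ∀ (η : ℝ → Vec m) (ω ω' V V' : ℝ → Vec n),
        (∀ t ≥ (0:ℝ), HasDerivAt η ((incD ep1 ep2)ᵀ.mulVec (ω t)) t) →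
        (∀ t ≥ (0:ℝ), HasDerivAt ω (ω' t) t) →
        (∀ t ≥ (0:ℝ), (Matrix.diagonal Md).mulVec (ω' t)
          = ub - (incD ep1 ep2).mulVec ((Gam ep1 ep2 B (V t)).mulVec (sinv (η t)))
            - (Matrix.diagonal Ad).mulVec (ω t) - Pl) →
        (∀ t ≥ (0:ℝ), HasDerivAt V (V' t) t) →
        (∀ t ≥ (0:ℝ), (Matrix.diagonal Td).mulVec (V' t)
          = -(Emat ep1 ep2 B Bii Xd Xd' (η t)).mulVec (V t) + Efd) →
        (η 0, ω 0, V 0) ∈ U →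
        (∃ C : ℝ, ∀ t ≥ (0:ℝ), ‖η t‖ + ‖ω t‖ + ‖V t‖ ≤ C) ∧
        Tendsto ω atTop (𝓝 ωb) ∧
        Tendsto (fun t => (Emat ep1 ep2 B Bii Xd Xd' (η t)).mulVec (V t) - Efd)
          atTop (𝓝 0) ∧
        Tendsto (fun t => Metric.infDist ((η t, ω t, V t) : Vec m × Vec n × Vec n)
          {p : Vec m × Vec n × Vec n |
            (incD ep1 ep2)ᵀ.mulVec p.2.1 = 0 ∧
            (0 : Vec n) = ub
              - (incD ep1 ep2).mulVec ((Gam ep1 ep2 B p.2.2).mulVec (sinv p.1))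
              - (Matrix.diagonal Ad).mulVec p.2.1 - Pl ∧
            (Emat ep1 ep2 B Bii Xd Xd' p.1).mulVec p.2.2 = Efd}) atTop (𝓝 0) := by
  have hcos : ∀ k, 0 < Real.cos (ηb k) := fun k => Real.cos_pos_of_mem_Ioo (hsec k)
  set σ : Vec m := (Gam ep1 ep2 B Vb).mulVec (sinv ηb) with hσ
  set F : Vec n := fun i => (1 - Bii i * (Xd i - Xd' i)) / (Xd i - Xd' i) with hF
  set P : Vec m × Vec n × Vec n → Vec n := fun p =>
    ub - (incD ep1 ep2).mulVec ((Gam ep1 ep2 B p.2.2).mulVec (sinv p.1))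
      - (Matrix.diagonal Ad).mulVec p.2.1 - Pl with hP
  set R : Vec m × Vec n × Vec n → Vec n := fun p =>
    (Emat ep1 ep2 B Bii Xd Xd' p.1).mulVec p.2.2 - Efd with hR
  set D : Vec m × Vec n × Vec n → Vec m := fun p => (incD ep1 ep2)ᵀ.mulVec p.2.1 with hD
  have hPc : Continuous P := continuous_powerBalance B Ad Pl ub
  have hRc : Continuous R := (continuous_Emat_mulVec B Bii Xd Xd').sub continuous_const
  have hDc : Continuous D := continuous_const.matrix_mulVec (by fun_prop)
  set f : Vec m × Vec n × Vec n → Vec m × Vec n × Vec n := fun p =>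
    (D p, fun i => P p i / Md i, fun i => -R p i / Td i) with hf
  have hfc : Continuous f := by fun_prop
  set g : Vec m × Vec n × Vec n → ℝ := fun p =>
    ∑ i, (Ad i * (p.2.1 i - ωb i) ^ 2 + R p i ^ 2 / Td i) with hg
  have hgc : Continuous g := by fun_prop
  have hterm1 : ∀ p i, 0 ≤ Ad i * ((p : Vec m × Vec n × Vec n).2.1 i - ωb i) ^ 2 := fun p i =>
    mul_nonneg (hA i).le (sq_nonneg _)
  have hterm2 : ∀ p i, 0 ≤ R p i ^ 2 / Td i := fun p i => div_nonneg (sq_nonneg _) (hT i).le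
  have hgterm : ∀ p i, Ad i * (p.2.1 i - ωb i) ^ 2 + R p i ^ 2 / Td i ≤ g p := fun p i =>
    Finset.single_le_sum (f := fun i => Ad i * (p.2.1 i - ωb i) ^ 2 + R p i ^ 2 / Td i)
      (fun j _ => add_nonneg (hterm1 p j) (hterm2 p j)) (Finset.mem_univ i)
  have hdiss : ∀ p, energyDeriv ep1 ep2 B F Md Efd ωb σ p (f p) = -g p := by
    intro p
    rw [hF, energyDeriv_eq hep]
    have e1 : (Matrix.diagonal Md).mulVec (f p).2.1 = P p := by
      funext i
      rw [Matrix.mulVec_diagonal]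
      exact mul_div_cancel₀ _ (hM i).ne'
    have e2 : P p = -(incD ep1 ep2).mulVec ((Gam ep1 ep2 B p.2.2).mulVec (sinv p.1) - σ) -
        (Matrix.diagonal Ad).mulVec (p.2.1 - ωb) := by
      rw [Matrix.mulVec_sub, Matrix.mulVec_sub]
      calc P p = P p - 0 := (sub_zero _).symm
        _ = _ := by rw [heq2]; simp only [hP]; abel
    have e3 : (f p).1 = (incD ep1 ep2)ᵀ.mulVec (p.2.1 - ωb) := by
      rw [Matrix.mulVec_sub, heq1, sub_zero]
    rw [e1, e2, e3, dotProduct_sub, dotProduct_neg,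
      Matrix.dotProduct_mulVec _ (incD ep1 ep2)ᵀ, Matrix.vecMul_transpose,
      dotProduct_comm ((incD ep1 ep2).mulVec _)]
    have e4 : (p.2.1 - ωb) ⬝ᵥ (Matrix.diagonal Ad).mulVec (p.2.1 - ωb) =
        ∑ i, Ad i * (p.2.1 i - ωb i) ^ 2 := by
      simp only [dotProduct, Matrix.mulVec_diagonal, Pi.sub_apply]
      exact Finset.sum_congr rfl fun i _ => by ring
    have e5 : (f p).2.2 ⬝ᵥ R p = -∑ i, R p i ^ 2 / Td i := by
      simp only [dotProduct, hf, ← Finset.sum_neg_distrib]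
      exact Finset.sum_congr rfl fun i _ => by ring
    simp only [hg, Finset.sum_add_distrib, ← e4]
    change _ + (f p).2.2 ⬝ᵥ R p + _ = _
    rw [e5]
    ring
  obtain ⟨r, hr, hmin⟩ := exists_closedBall_strict_min
    (energy ep1 ep2 B F Md Efd ωb σ) (energyDeriv ep1 ep2 B F Md Efd ωb σ)
    (energyDeriv2 ep1 ep2 B F Md) (ηb, ωb, Vb)
    (fun x v s => hasDerivAt_energy ep1 ep2 B F Md Efd ωb σ
      (by simpa using ((hasDerivAt_id s).smul_const v).const_add x))
    (hasDerivAt_energyDeriv ep1 ep2 B F Md Efd ωb σ)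
    (fun v => by rw [hF, energyDeriv_eq hep]; simp [heq3, hσ])
    (continuous_energyDeriv2 ep1 ep2 B F Md) (energyDeriv2_smul ep1 ep2 B F Md)
    (fun v hv => energyDeriv2_equilibrium_pos hep hB hM ωb hcos hVb hPD hv)
  obtain ⟨U, hU, hUtrap⟩ := exists_nhds_trapped_of_strict_min hfc
    (continuous_energy ep1 ep2 B F Md Efd ωb σ) hgc
    (fun p => Finset.sum_nonneg fun i _ => add_nonneg (hterm1 p i) (hterm2 p i)) hr hmin
  refine ⟨U, hU, fun η ω ω' V V' hη hω hω' hV hV' h0 => ?_⟩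
  set x : ℝ → Vec m × Vec n × Vec n := fun t => (η t, ω t, V t) with hx
  have hω'f : ∀ t ≥ (0 : ℝ), ω' t = (f (x t)).2.1 := fun t ht => by
    funext i
    have := congrFun (hω' t ht) i
    rw [Matrix.mulVec_diagonal] at this
    exact eq_div_of_mul_eq (hM i).ne' ((mul_comm _ _).trans this)
  have hV'f : ∀ t ≥ (0 : ℝ), V' t = (f (x t)).2.2 := fun t ht => by
    funext i
    have := congrFun (hV' t ht) i
    rw [Matrix.mulVec_diagonal] at this
    refine eq_div_of_mul_eq (hT i).ne' ((mul_comm _ _).trans (this.trans ?_))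
    simp only [hR, hx, Pi.add_apply, Pi.neg_apply, Pi.sub_apply]
    ring
  have hode : ∀ t ≥ (0 : ℝ), HasDerivAt x (f (x t)) t := fun t ht => by
    have := (hη t ht).prodMk ((hω t ht).prodMk (hV t ht))
    rwa [hω'f t ht, hV'f t ht] at this
  obtain ⟨htrap, hglim⟩ := hUtrap x h0 hode fun t ht => by
    rw [← hdiss]
    exact hasDerivAt_energy ep1 ep2 B F Md Efd ωb σ (hode t ht)
  have hωlim : Tendsto ω atTop (𝓝 ωb) := by
    refine tendsto_pi_nhds.2 fun i => ?_
    rw [← tendsto_sub_nhds_zero_iff, tendsto_zero_iff_abs_tendsto_zero]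
    have hs : Tendsto (fun t => Real.sqrt (g (x t) / Ad i)) atTop (𝓝 0) := by
      simpa using (hglim.div_const (Ad i)).sqrt
    refine squeeze_zero (fun t => abs_nonneg _) (fun t => Real.abs_le_sqrt ?_) hs
    rw [le_div_iff₀ (hA i), mul_comm]
    exact (le_add_of_nonneg_right (hterm2 _ i)).trans (hgterm (x t) i)
  have hRlim : Tendsto (fun t => R (x t)) atTop (𝓝 0) := by
    refine tendsto_pi_nhds.2 fun i => ?_
    rw [Pi.zero_apply, tendsto_zero_iff_abs_tendsto_zero]
    have hs : Tendsto (fun t => Real.sqrt (g (x t) * Td i)) atTop (𝓝 0) := by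
      simpa using (hglim.mul_const (Td i)).sqrt
    refine squeeze_zero (fun t => abs_nonneg _) (fun t => Real.abs_le_sqrt ?_) hs
    rw [← div_le_iff₀ (hT i)]
    exact (le_add_of_nonneg_left (hterm1 _ i)).trans (hgterm (x t) i)
  have hDlim : Tendsto (fun t => D (x t)) atTop (𝓝 0) := by
    have hc : Continuous fun w : Vec n => (incD ep1 ep2)ᵀ.mulVec w :=
      continuous_const.matrix_mulVec continuous_id
    have := (hc.tendsto ωb).comp hωlim
    rwa [heq1] at this
  have hPlim : Tendsto (fun t => P (x t)) atTop (𝓝 0) := by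
    have h1 := tendsto_deriv_zero_of_uniformContinuousOn
      (fun t ht => (hω'f t ht) ▸ hω t ht : ∀ t ≥ (0 : ℝ), HasDerivAt ω (f (x t)).2.1 t) hωlim
      (uniformContinuousOn_comp_solution hfc (isCompact_closedBall _ r) hode htrap
        (g := fun p => (f p).2.1) (by fun_prop))
    refine tendsto_pi_nhds.2 fun i => ?_
    have h2 := (tendsto_pi_nhds.1 h1 i).mul_const (Md i)
    simp only [Pi.zero_apply, zero_mul] at h2
    exact h2.congr fun t => div_mul_cancel₀ _ (hM i).ne'
  refine ⟨?_, hωlim, hRlim, ?_⟩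
  · obtain ⟨C, hC⟩ := (isCompact_closedBall (ηb, ωb, Vb) r).exists_bound_of_continuousOn
      (f := fun p : Vec m × Vec n × Vec n => ‖p.1‖ + ‖p.2.1‖ + ‖p.2.2‖) (by fun_prop)
    exact ⟨C, fun t ht => (le_abs_self _).trans (hC _ (htrap t ht))⟩
  · have := tendsto_infDist_zeros (isCompact_closedBall (ηb, ωb, Vb) r)
      (h := fun p => (D p, P p, R p)) (by fun_prop) htrap
      (hDlim.prodMk_nhds (hPlim.prodMk_nhds hRlim))
    convert this using 4 with t
    ext p
    simp only [hD, hP, hR, Prod.mk_eq_zero, sub_eq_zero (b := Efd),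
      eq_comm (a := (0 : Vec n))]
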